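/- Let (Ω, 𝓕, P) be a probability space, G : Ω → ℝⁿˣⁿ measurable and essentially bounded, (G̃ₖ)ₖ∈ℕ and (Ḡₖ)ₖ∈ℕ sequences of measurable ℝⁿˣⁿ-valued random variables with ∑ₖ E|G̃ₖ|² < ∞ and ∑ₖ E|Ḡₖ|² < ∞, and (Ĝᵢⱼ)ᵢ,ⱼ∈ℕ a family of integrable ℝⁿˣⁿ-valued random variables with ∑ᵢ,ⱼ |E[Ĝᵢⱼ]|² < ∞. Then the map 𝒢ξ = Gξ + ∑ₖ G̃ₖᵀ E[Ḡₖ ξ] + ∑ₖ Ḡₖᵀ E[G̃ₖ ξ] + ∑ᵢ,ⱼ G̃ᵢᵀ E[Ĝᵢⱼ] E[G̃ⱼ ξ] (all series converging in L²(Ω; ℝⁿ)) defines a bounded linear operator on L²(Ω; ℝⁿ), with ‖𝒢‖ ≤ esssup_{ω∈Ω}|G(ω)| + ∑ₖ E|G̃ₖ|² + ∑ₖ E|Ḡₖ|² + (∑ᵢ,ⱼ |E[Ĝᵢⱼ]|²)^{1/2} (∑ₖ E|G̃ₖ|²). -/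

import Mathlib

open MeasureTheory Filter

/-- Matrix–vector multiplication, viewed as a map between Euclidean spaces. -/
noncomputable def matVec {n m : ℕ} (M : Matrix (Fin n) (Fin m) ℝ)
    (v : EuclideanSpace ℝ (Fin m)) : EuclideanSpace ℝ (Fin n) :=
  (WithLp.equiv 2 (Fin n → ℝ)).symm (M.mulVec ((WithLp.equiv 2 (Fin m → ℝ)) v))

/-- Square of the Frobenius norm of a real matrix. -/
def frobSq {n m : ℕ} (M : Matrix (Fin n) (Fin m) ℝ) : ℝ := ∑ i, ∑ j, (M i j) ^ 2

/-- Frobenius norm of a real matrix. -/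
noncomputable def frob {n m : ℕ} (M : Matrix (Fin n) (Fin m) ℝ) : ℝ :=
  Real.sqrt (frobSq M)

/-- Entrywise expectation of a matrix-valued random variable. -/
noncomputable def matExp {n m : ℕ} {Ω : Type*} [MeasurableSpace Ω] (P : MeasureTheory.Measure Ω)
    (M : Ω → Matrix (Fin n) (Fin m) ℝ) : Matrix (Fin n) (Fin m) ℝ :=
  Matrix.of fun a b => ∫ ω, M ω a b ∂P

section FrobeniusNorm

variable {n m : ℕ}

lemma frobSq_nonneg (M : Matrix (Fin n) (Fin m) ℝ) : 0 ≤ frobSq M :=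
  Finset.sum_nonneg fun _ _ => Finset.sum_nonneg fun _ _ => sq_nonneg _

lemma frob_nonneg (M : Matrix (Fin n) (Fin m) ℝ) : 0 ≤ frob M := Real.sqrt_nonneg _

lemma frob_sq (M : Matrix (Fin n) (Fin m) ℝ) : frob M ^ 2 = frobSq M :=
  Real.sq_sqrt (frobSq_nonneg M)

lemma frob_transpose (M : Matrix (Fin n) (Fin m) ℝ) : frob M.transpose = frob M :=
  congrArg Real.sqrt Finset.sum_comm

lemma matVec_add (M : Matrix (Fin n) (Fin m) ℝ) (v w : EuclideanSpace ℝ (Fin m)) :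
    matVec M (v + w) = matVec M v + matVec M w := by
  simp [matVec, Matrix.mulVec_add]

lemma matVec_smul (M : Matrix (Fin n) (Fin m) ℝ) (c : ℝ) (v : EuclideanSpace ℝ (Fin m)) :
    matVec M (c • v) = c • matVec M v := by
  simp [matVec, Matrix.mulVec_smul]

lemma matVec_apply (M : Matrix (Fin n) (Fin m) ℝ) (v : EuclideanSpace ℝ (Fin m)) (i : Fin n) :
    matVec M v i = ∑ j, M i j * v j := rfl

lemma norm_matVec_le (M : Matrix (Fin n) (Fin m) ℝ) (v : EuclideanSpace ℝ (Fin m)) :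
    ‖matVec M v‖ ≤ frob M * ‖v‖ := by
  rw [frob, EuclideanSpace.norm_eq, EuclideanSpace.norm_eq, ← Real.sqrt_mul (frobSq_nonneg M)]
  refine Real.sqrt_le_sqrt ?_
  rw [frobSq, Finset.sum_mul]
  refine Finset.sum_le_sum fun i _ => ?_
  simpa [matVec_apply] using Finset.sum_mul_sq_le_sq_mul_sq Finset.univ (M i) v

lemma inner_matVec_transpose (M : Matrix (Fin n) (Fin m) ℝ) (v : EuclideanSpace ℝ (Fin n))
    (w : EuclideanSpace ℝ (Fin m)) :
    inner ℝ (matVec M.transpose v) w = inner ℝ v (matVec M w) := by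
  simp only [PiLp.inner_apply, matVec_apply, RCLike.inner_apply, conj_trivial, Finset.mul_sum,
    Finset.sum_mul, Matrix.transpose_apply]
  rw [Finset.sum_comm]
  exact Finset.sum_congr rfl fun _ _ => Finset.sum_congr rfl fun _ _ => by ring

/-- Multiplication by a matrix as a continuous linear map between Euclidean spaces. -/
noncomputable def matVecCLM (M : Matrix (Fin n) (Fin m) ℝ) :
    EuclideanSpace ℝ (Fin m) →L[ℝ] EuclideanSpace ℝ (Fin n) :=
  LinearMap.mkContinuous ⟨⟨matVec M, matVec_add M⟩, matVec_smul M⟩ (frob M) (norm_matVec_le M)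

lemma norm_matVecCLM_le (M : Matrix (Fin n) (Fin m) ℝ) : ‖matVecCLM M‖ ≤ frob M :=
  LinearMap.mkContinuous_norm_le _ (frob_nonneg M) _

variable {Ω : Type*} [MeasurableSpace Ω] {P : Measure Ω} {M : Ω → Matrix (Fin n) (Fin m) ℝ}

lemma measurable_frobSq (hM : ∀ i j, Measurable fun ω => M ω i j) :
    Measurable fun ω => frobSq (M ω) := by
  unfold frobSq
  fun_prop

lemma measurable_frob (hM : ∀ i j, Measurable fun ω => M ω i j) :
    Measurable fun ω => frob (M ω) :=
  (measurable_frobSq hM).sqrt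

lemma aestronglyMeasurable_matVec (hM : ∀ i j, Measurable fun ω => M ω i j)
    {v : Ω → EuclideanSpace ℝ (Fin m)} (hv : AEStronglyMeasurable v P) :
    AEStronglyMeasurable (fun ω => matVec (M ω) (v ω)) P := by
  refine AEMeasurable.aestronglyMeasurable ?_
  have hv' : ∀ j, AEMeasurable (fun ω => v ω j) P := fun j =>
    (EuclideanSpace.proj (𝕜 := ℝ) j).continuous.measurable.comp_aemeasurable hv.aemeasurable
  refine (WithLp.measurable_toLp 2 (Fin n → ℝ)).comp_aemeasurable
    (aemeasurable_pi_lambda _ fun i => ?_)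
  exact Finset.aemeasurable_fun_sum Finset.univ fun j _ => (hM i j).aemeasurable.mul (hv' j)

lemma memLp_frob (hM : ∀ i j, Measurable fun ω => M ω i j)
    (hInt : Integrable (fun ω => frobSq (M ω)) P) : MemLp (fun ω => frob (M ω)) 2 P := by
  rw [memLp_two_iff_integrable_sq (measurable_frob hM).aestronglyMeasurable]
  simpa only [frob_sq] using hInt

lemma norm_toLp_frob (hM : ∀ i j, Measurable fun ω => M ω i j)
    (hInt : Integrable (fun ω => frobSq (M ω)) P) :
    ‖(memLp_frob hM hInt).toLp‖ = Real.sqrt (∫ ω, frobSq (M ω) ∂P) := by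
  rw [← Real.sqrt_sq (norm_nonneg _), ← real_inner_self_eq_norm_sq, L2.inner_def]
  congr 1
  refine integral_congr_ae ?_
  filter_upwards [(memLp_frob hM hInt).coeFn_toLp] with ω hω
  rw [hω, real_inner_self_eq_norm_sq, Real.norm_eq_abs, sq_abs, frob_sq]

end FrobeniusNorm

section RandomMatrix

variable {n m : ℕ} {Ω : Type*} [MeasurableSpace Ω] {P : Measure Ω}
  {M : Ω → Matrix (Fin n) (Fin m) ℝ}

lemma memLp_matVec_transpose (hM : ∀ i j, Measurable fun ω => M ω i j)
    (hInt : Integrable (fun ω => frobSq (M ω)) P) (v : EuclideanSpace ℝ (Fin n)) :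
    MemLp (fun ω => matVec (M ω).transpose v) 2 P := by
  refine (memLp_frob hM hInt).of_le_mul (c := ‖v‖)
    (aestronglyMeasurable_matVec (fun i j => hM j i) aestronglyMeasurable_const)
    (ae_of_all _ fun ω => ?_)
  rw [Real.norm_of_nonneg (frob_nonneg _), mul_comm, ← frob_transpose]
  exact norm_matVec_le _ _

/-- The operator `v ↦ Mᵀ v` from vectors to square-integrable random vectors. -/
noncomputable def randomTranspose (hM : ∀ i j, Measurable fun ω => M ω i j)
    (hInt : Integrable (fun ω => frobSq (M ω)) P) :
    EuclideanSpace ℝ (Fin n) →L[ℝ] Lp (EuclideanSpace ℝ (Fin m)) 2 P :=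
  LinearMap.mkContinuous
    { toFun := fun v => (memLp_matVec_transpose hM hInt v).toLp
      map_add' := fun v w => by
        rw [← MemLp.toLp_add]
        exact MemLp.toLp_congr _ _ (ae_of_all _ fun ω => matVec_add _ v w)
      map_smul' := fun c v => by
        rw [RingHom.id_apply, ← MemLp.toLp_const_smul]
        exact MemLp.toLp_congr _ _ (ae_of_all _ fun ω => matVec_smul _ c v) }
    (Real.sqrt (∫ ω, frobSq (M ω) ∂P)) fun v => by
      rw [← norm_toLp_frob hM hInt, mul_comm]
      refine Lp.norm_le_mul_norm_of_ae_le_mul ?_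
      filter_upwards [(memLp_frob hM hInt).coeFn_toLp,
        (memLp_matVec_transpose hM hInt v).coeFn_toLp] with ω h₁ h₂
      simp only [LinearMap.coe_mk, AddHom.coe_mk]
      rw [h₁, h₂, Real.norm_of_nonneg (frob_nonneg _), mul_comm, ← frob_transpose]
      exact norm_matVec_le _ _

lemma norm_randomTranspose_le (hM : ∀ i j, Measurable fun ω => M ω i j)
    (hInt : Integrable (fun ω => frobSq (M ω)) P) :
    ‖randomTranspose hM hInt‖ ≤ Real.sqrt (∫ ω, frobSq (M ω) ∂P) :=
  LinearMap.mkContinuous_norm_le _ (Real.sqrt_nonneg _) _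

lemma randomTranspose_apply (hM : ∀ i j, Measurable fun ω => M ω i j)
    (hInt : Integrable (fun ω => frobSq (M ω)) P) (v : EuclideanSpace ℝ (Fin n)) :
    randomTranspose hM hInt v =ᵐ[P] fun ω => matVec (M ω).transpose v :=
  (memLp_matVec_transpose hM hInt v).coeFn_toLp

lemma integrable_matVec (hM : ∀ i j, Measurable fun ω => M ω i j)
    (hInt : Integrable (fun ω => frobSq (M ω)) P) (ξ : Lp (EuclideanSpace ℝ (Fin m)) 2 P) :
    Integrable (fun ω => matVec (M ω) (ξ ω)) P := by
  refine ((memLp_frob hM hInt).integrable_mul (Lp.memLp ξ).norm).mono'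
    (aestronglyMeasurable_matVec hM (Lp.aestronglyMeasurable ξ)) (ae_of_all _ fun ω => ?_)
  exact norm_matVec_le _ _

open ContinuousLinearMap in
lemma adjoint_randomTranspose_apply (hM : ∀ i j, Measurable fun ω => M ω i j)
    (hInt : Integrable (fun ω => frobSq (M ω)) P) (ξ : Lp (EuclideanSpace ℝ (Fin m)) 2 P) :
    adjoint (randomTranspose hM hInt) ξ = ∫ ω, matVec (M ω) (ξ ω) ∂P := by
  refine ext_inner_left ℝ fun v => ?_
  rw [adjoint_inner_right, ← integral_inner (integrable_matVec hM hInt ξ), L2.inner_def]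
  refine integral_congr_ae ?_
  filter_upwards [randomTranspose_apply hM hInt v] with ω hω
  rw [hω, inner_matVec_transpose]

lemma norm_adjoint_randomTranspose_le (hM : ∀ i j, Measurable fun ω => M ω i j)
    (hInt : Integrable (fun ω => frobSq (M ω)) P) :
    ‖ContinuousLinearMap.adjoint (randomTranspose hM hInt)‖ ≤
      Real.sqrt (∫ ω, frobSq (M ω) ∂P) :=
  (LinearIsometryEquiv.norm_map _ _).trans_le (norm_randomTranspose_le hM hInt)

lemma exists_pointwise_matVec_operator [NeZero P] (hM : ∀ i j, Measurable fun ω => M ω i j)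
    (hbdd : ∃ C : ℝ, ∀ᵐ ω ∂P, frob (M ω) ≤ C) :
    ∃ T : Lp (EuclideanSpace ℝ (Fin m)) 2 P →L[ℝ] Lp (EuclideanSpace ℝ (Fin n)) 2 P,
      ‖T‖ ≤ essSup (fun ω => frob (M ω)) P ∧
      ∀ ξ, T ξ =ᵐ[P] fun ω => matVec (M ω) (ξ ω) := by
  have hle : ∀ᵐ ω ∂P, frob (M ω) ≤ essSup (fun ω => frob (M ω)) P := ae_le_essSup hbdd
  have hnn : 0 ≤ essSup (fun ω => frob (M ω)) P := by
    obtain ⟨ω, hω⟩ := hle.exists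
    exact (frob_nonneg _).trans hω
  have hbound : ∀ ξ : Lp (EuclideanSpace ℝ (Fin m)) 2 P,
      ∀ᵐ ω ∂P, ‖matVec (M ω) (ξ ω)‖ ≤ essSup (fun ω => frob (M ω)) P * ‖ξ ω‖ := fun ξ => by
    filter_upwards [hle] with ω hω
    exact (norm_matVec_le _ _).trans (mul_le_mul_of_nonneg_right hω (norm_nonneg _))
  have hmem : ∀ ξ : Lp (EuclideanSpace ℝ (Fin m)) 2 P,
      MemLp (fun ω => matVec (M ω) (ξ ω)) 2 P := fun ξ =>
    (Lp.memLp ξ).of_le_mul (aestronglyMeasurable_matVec hM (Lp.aestronglyMeasurable ξ)) (hbound ξ)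
  let L : Lp (EuclideanSpace ℝ (Fin m)) 2 P →ₗ[ℝ] Lp (EuclideanSpace ℝ (Fin n)) 2 P :=
    { toFun := fun ξ => (hmem ξ).toLp
      map_add' := fun ξ η => by
        rw [← MemLp.toLp_add]
        refine MemLp.toLp_congr _ _ ?_
        filter_upwards [Lp.coeFn_add ξ η] with ω hω
        rw [hω]
        exact matVec_add _ _ _
      map_smul' := fun c ξ => by
        rw [RingHom.id_apply, ← MemLp.toLp_const_smul]
        refine MemLp.toLp_congr _ _ ?_
        filter_upwards [Lp.coeFn_smul c ξ] with ω hω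
        rw [hω]
        exact matVec_smul _ _ _ }
  have hL : ∀ ξ, L ξ =ᵐ[P] fun ω => matVec (M ω) (ξ ω) := fun ξ => (hmem ξ).coeFn_toLp
  refine ⟨L.mkContinuous _ fun ξ => Lp.norm_le_mul_norm_of_ae_le_mul ?_,
    L.mkContinuous_norm_le hnn _, hL⟩
  filter_upwards [hbound ξ, hL ξ] with ω h₁ h₂
  rwa [h₂]

end RandomMatrix

section OperatorSeries

variable {Ω E ι : Type*} [MeasurableSpace Ω] {P : Measure Ω} [NormedAddCommGroup E]
  [NormedSpace ℝ E] [CompleteSpace E] [Countable ι]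

/-- An absolutely summable series of operators on `L²` converges pointwise almost everywhere and
in `L²`, to the same limit. -/
lemma tsum_operator_Lp {A : ι → Lp E 2 P →L[ℝ] Lp E 2 P} (hA : Summable fun p => ‖A p‖)
    {F : ι → Ω → E} (ξ : Lp E 2 P) (hF : ∀ p, A p ξ =ᵐ[P] F p) :
    Tendsto (fun s : Finset ι => eLpNorm (fun ω => (∑ p ∈ s, F p ω) - ∑' p, F p ω) 2 P)
        atTop (nhds 0) ∧
      (∑' p, A p) ξ =ᵐ[P] fun ω => ∑' p, F p ω := by
  have hAξ : Summable fun p => ‖A p ξ‖ :=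
    (hA.mul_right ‖ξ‖).of_nonneg_of_le (fun _ => norm_nonneg _) fun p => (A p).le_opNorm ξ
  have hlim : HasSum (fun p => A p ξ) ((∑' p, A p) ξ) :=
    (ContinuousLinearMap.apply ℝ (Lp E 2 P) ξ).hasSum hA.of_norm.hasSum
  have hF' : ∀ᵐ ω ∂P, ∀ p, A p ξ ω = F p ω := ae_all_iff.2 hF
  have hae : (∑' p, A p) ξ =ᵐ[P] fun ω => ∑' p, F p ω := by
    filter_upwards [Lp.hasSum_coeFn_tsum (tsum_enorm_ne_top_iff_summable_norm.2 hAξ), hF']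
      with ω h₁ h₂
    rw [hlim.tsum_eq] at h₁
    simp only [← h₂, h₁.tsum_eq]
  refine ⟨?_, hae⟩
  refine ((Lp.tendsto_Lp_iff_tendsto_eLpNorm' _ _).1 hlim).congr fun s => eLpNorm_congr_ae ?_
  filter_upwards [Lp.coeFn_fun_finsetSum s fun p => A p ξ, hae, hF'] with ω h₁ h₂ h₃
  simp only [Pi.sub_apply, h₁, h₂, h₃]

end OperatorSeries

/-- Cauchy–Schwarz inequality for square-summable families. -/
lemma summable_mul_and_tsum_mul_le_sqrt_mul_sqrt {ι : Type*} {f g : ι → ℝ} (hf : ∀ i, 0 ≤ f i)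
    (hg : ∀ i, 0 ≤ g i) (hfs : Summable fun i => f i ^ 2) (hgs : Summable fun i => g i ^ 2) :
    (Summable fun i => f i * g i) ∧
      ∑' i, f i * g i ≤ Real.sqrt (∑' i, f i ^ 2) * Real.sqrt (∑' i, g i ^ 2) := by
  simpa only [Real.rpow_two, Real.sqrt_eq_rpow] using
    Real.summable_and_inner_le_Lp_mul_Lq_tsum_of_nonneg Real.HolderConjugate.two_two hf hg
      (by simpa only [Real.rpow_two] using hfs) (by simpa only [Real.rpow_two] using hgs)

/-- Norm summability of a family dominated by products of square-summable families. -/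
lemma summable_norm_and_norm_tsum_le {ι V : Type*} [NormedAddCommGroup V]
    {A : ι → V} {f g : ι → ℝ} (hf : ∀ i, 0 ≤ f i) (hg : ∀ i, 0 ≤ g i)
    (hfs : Summable fun i => f i ^ 2) (hgs : Summable fun i => g i ^ 2)
    (hA : ∀ i, ‖A i‖ ≤ f i * g i) :
    (Summable fun i => ‖A i‖) ∧
      ‖∑' i, A i‖ ≤ Real.sqrt (∑' i, f i ^ 2) * Real.sqrt (∑' i, g i ^ 2) := by
  obtain ⟨hs, hle⟩ := summable_mul_and_tsum_mul_le_sqrt_mul_sqrt hf hg hfs hgs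
  exact ⟨hs.of_nonneg_of_le (fun _ => norm_nonneg _) hA,
    (tsum_of_norm_bounded hs.hasSum hA).trans hle⟩

/-- The mean-field operator
`𝒢ξ = Gξ + ∑ₖ G̃ₖᵀ E[Ḡₖ ξ] + ∑ₖ Ḡₖᵀ E[G̃ₖ ξ] + ∑ᵢⱼ G̃ᵢᵀ E[Ĝᵢⱼ] E[G̃ⱼ ξ]`
(with all series converging in `L²`) is a bounded linear operator on `L²(Ω; ℝⁿ)` with
`‖𝒢‖ ≤ esssup|G| + ∑ₖ E|G̃ₖ|² + ∑ₖ E|Ḡₖ|² + (∑ᵢⱼ |E[Ĝᵢⱼ]|²)^{1/2} (∑ₖ E|G̃ₖ|²)`. -/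
theorem meanField_terminal_operator_bounded
    (n : ℕ) {Ω : Type*} [MeasurableSpace Ω] (P : Measure Ω) [IsProbabilityMeasure P]
    (G : Ω → Matrix (Fin n) (Fin n) ℝ)
    (Gtil Gbar : ℕ → Ω → Matrix (Fin n) (Fin n) ℝ)
    (Ghat : ℕ → ℕ → Ω → Matrix (Fin n) (Fin n) ℝ)
    (hGmeas : ∀ i j, Measurable fun ω => G ω i j)
    (hGbdd : ∃ C : ℝ, ∀ᵐ ω ∂P, frob (G ω) ≤ C)
    (hGtilMeas : ∀ k i j, Measurable fun ω => Gtil k ω i j)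
    (hGbarMeas : ∀ k i j, Measurable fun ω => Gbar k ω i j)
    (hGtilInt : ∀ k, Integrable (fun ω => frobSq (Gtil k ω)) P)
    (hGbarInt : ∀ k, Integrable (fun ω => frobSq (Gbar k ω)) P)
    (hGtilSum : Summable fun k => ∫ ω, frobSq (Gtil k ω) ∂P)
    (hGbarSum : Summable fun k => ∫ ω, frobSq (Gbar k ω) ∂P)
    (hGhatInt : ∀ i j a b, Integrable (fun ω => Ghat i j ω a b) P)
    (hGhatSum : Summable fun p : ℕ × ℕ => frobSq (matExp P (Ghat p.1 p.2))) :
    (∀ ξ : Lp (EuclideanSpace ℝ (Fin n)) 2 P,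
      Tendsto (fun s : Finset ℕ =>
          eLpNorm (fun ω =>
              (∑ k ∈ s, matVec (Gtil k ω).transpose (∫ ω', matVec (Gbar k ω') (ξ ω') ∂P)) -
              ∑' k, matVec (Gtil k ω).transpose (∫ ω', matVec (Gbar k ω') (ξ ω') ∂P)) 2 P)
        atTop (nhds 0) ∧
      Tendsto (fun s : Finset ℕ =>
          eLpNorm (fun ω =>
              (∑ k ∈ s, matVec (Gbar k ω).transpose (∫ ω', matVec (Gtil k ω') (ξ ω') ∂P)) -
              ∑' k, matVec (Gbar k ω).transpose (∫ ω', matVec (Gtil k ω') (ξ ω') ∂P)) 2 P)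
        atTop (nhds 0) ∧
      Tendsto (fun s : Finset (ℕ × ℕ) =>
          eLpNorm (fun ω =>
              (∑ p ∈ s, matVec (Gtil p.1 ω).transpose
                  (matVec (matExp P (Ghat p.1 p.2))
                    (∫ ω', matVec (Gtil p.2 ω') (ξ ω') ∂P))) -
              ∑' p : ℕ × ℕ, matVec (Gtil p.1 ω).transpose
                  (matVec (matExp P (Ghat p.1 p.2))
                    (∫ ω', matVec (Gtil p.2 ω') (ξ ω') ∂P))) 2 P)
        atTop (nhds 0)) ∧
    ∃ 𝒢 : Lp (EuclideanSpace ℝ (Fin n)) 2 P →L[ℝ] Lp (EuclideanSpace ℝ (Fin n)) 2 P,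
      ‖𝒢‖ ≤ essSup (fun ω => frob (G ω)) P +
          (∑' k, ∫ ω, frobSq (Gtil k ω) ∂P) + (∑' k, ∫ ω, frobSq (Gbar k ω) ∂P) +
          Real.sqrt (∑' p : ℕ × ℕ, frobSq (matExp P (Ghat p.1 p.2))) *
            (∑' k, ∫ ω, frobSq (Gtil k ω) ∂P) ∧
      ∀ ξ : Lp (EuclideanSpace ℝ (Fin n)) 2 P,
        (𝒢 ξ : Ω → EuclideanSpace ℝ (Fin n)) =ᵐ[P]
          fun ω => matVec (G ω) (ξ ω) +
            (∑' k, matVec (Gtil k ω).transpose (∫ ω', matVec (Gbar k ω') (ξ ω') ∂P)) +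
            (∑' k, matVec (Gbar k ω).transpose (∫ ω', matVec (Gtil k ω') (ξ ω') ∂P)) +
            ∑' p : ℕ × ℕ, matVec (Gtil p.1 ω).transpose
              (matVec (matExp P (Ghat p.1 p.2))
                (∫ ω', matVec (Gtil p.2 ω') (ξ ω') ∂P)) := by
  set a : ℕ → ℝ := fun k => ∫ ω, frobSq (Gtil k ω) ∂P
  set b : ℕ → ℝ := fun k => ∫ ω, frobSq (Gbar k ω) ∂P
  have ha0 : ∀ k, 0 ≤ a k := fun k => integral_nonneg fun _ => frobSq_nonneg _
  have hb0 : ∀ k, 0 ≤ b k := fun k => integral_nonneg fun _ => frobSq_nonneg _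
  have hasq : ∀ k, Real.sqrt (a k) ^ 2 = a k := fun k => Real.sq_sqrt (ha0 k)
  have hbsq : ∀ k, Real.sqrt (b k) ^ 2 = b k := fun k => Real.sq_sqrt (hb0 k)
  let R := fun k => randomTranspose (hGtilMeas k) (hGtilInt k)
  let S := fun k => randomTranspose (hGbarMeas k) (hGbarInt k)
  have hR : ∀ k, ‖R k‖ ≤ Real.sqrt (a k) := fun k => norm_randomTranspose_le _ _
  have hS : ∀ k, ‖S k‖ ≤ Real.sqrt (b k) := fun k => norm_randomTranspose_le _ _
  have hR' : ∀ k, ‖(R k).adjoint‖ ≤ Real.sqrt (a k) := fun k =>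
    norm_adjoint_randomTranspose_le _ _
  have hS' : ∀ k, ‖(S k).adjoint‖ ≤ Real.sqrt (b k) := fun k =>
    norm_adjoint_randomTranspose_le _ _
  let A := fun k => R k ∘L (S k).adjoint
  let B := fun k => S k ∘L (R k).adjoint
  let D := fun p : ℕ × ℕ => R p.1 ∘L matVecCLM (matExp P (Ghat p.1 p.2)) ∘L (R p.2).adjoint
  have hAF : ∀ ξ k, A k ξ =ᵐ[P] fun ω =>
      matVec (Gtil k ω).transpose (∫ ω', matVec (Gbar k ω') (ξ ω') ∂P) := fun ξ k => by
    rw [← adjoint_randomTranspose_apply (hGbarMeas k) (hGbarInt k)]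
    exact randomTranspose_apply (hGtilMeas k) (hGtilInt k) _
  have hBF : ∀ ξ k, B k ξ =ᵐ[P] fun ω =>
      matVec (Gbar k ω).transpose (∫ ω', matVec (Gtil k ω') (ξ ω') ∂P) := fun ξ k => by
    rw [← adjoint_randomTranspose_apply (hGtilMeas k) (hGtilInt k)]
    exact randomTranspose_apply (hGbarMeas k) (hGbarInt k) _
  have hDF : ∀ ξ (p : ℕ × ℕ), D p ξ =ᵐ[P] fun ω => matVec (Gtil p.1 ω).transpose
      (matVec (matExp P (Ghat p.1 p.2)) (∫ ω', matVec (Gtil p.2 ω') (ξ ω') ∂P)) := fun ξ p => by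
    rw [← adjoint_randomTranspose_apply (hGtilMeas p.2) (hGtilInt p.2)]
    exact randomTranspose_apply (hGtilMeas p.1) (hGtilInt p.1) _
  have hprod : Summable fun p : ℕ × ℕ => a p.1 * a p.2 :=
    hGtilSum.mul_of_nonneg hGtilSum ha0 ha0
  have hprod_tsum : ∑' p : ℕ × ℕ, a p.1 * a p.2 = (∑' k, a k) * ∑' k, a k :=
    (hGtilSum.tsum_mul_tsum hGtilSum hprod).symm
  have hsq : ∀ p : ℕ × ℕ, (Real.sqrt (a p.1) * Real.sqrt (a p.2)) ^ 2 = a p.1 * a p.2 :=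
    fun p => by rw [mul_pow, hasq, hasq]
  obtain ⟨hAs, hAn⟩ := summable_norm_and_norm_tsum_le (A := A)
    (fun k => Real.sqrt_nonneg (a k)) (fun k => Real.sqrt_nonneg (b k))
    (by simpa only [hasq] using hGtilSum) (by simpa only [hbsq] using hGbarSum) fun k =>
      (ContinuousLinearMap.opNorm_comp_le _ _).trans
        (mul_le_mul (hR k) (hS' k) (norm_nonneg _) (Real.sqrt_nonneg _))
  obtain ⟨hBs, hBn⟩ := summable_norm_and_norm_tsum_le (A := B)
    (fun k => Real.sqrt_nonneg (b k)) (fun k => Real.sqrt_nonneg (a k))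
    (by simpa only [hbsq] using hGbarSum) (by simpa only [hasq] using hGtilSum) fun k =>
      (ContinuousLinearMap.opNorm_comp_le _ _).trans
        (mul_le_mul (hS k) (hR' k) (norm_nonneg _) (Real.sqrt_nonneg _))
  obtain ⟨hDs, hDn⟩ := summable_norm_and_norm_tsum_le (A := D)
    (fun p => frob_nonneg (matExp P (Ghat p.1 p.2)))
    (fun p => mul_nonneg (Real.sqrt_nonneg (a p.1)) (Real.sqrt_nonneg (a p.2)))
    (by simpa only [frob_sq] using hGhatSum) (by simpa only [hsq] using hprod) fun p => by
      have h₁ : ‖matVecCLM (matExp P (Ghat p.1 p.2)) ∘L (R p.2).adjoint‖ ≤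
          frob (matExp P (Ghat p.1 p.2)) * Real.sqrt (a p.2) :=
        (ContinuousLinearMap.opNorm_comp_le _ _).trans
          (mul_le_mul (norm_matVecCLM_le _) (hR' _) (norm_nonneg _) (frob_nonneg _))
      refine (ContinuousLinearMap.opNorm_comp_le _ _).trans
        ((mul_le_mul (hR _) h₁ (norm_nonneg _) (Real.sqrt_nonneg _)).trans_eq ?_)
      ring
  simp only [hasq, hbsq] at hAn hBn
  simp only [frob_sq, hsq, hprod_tsum, Real.sqrt_mul_self (tsum_nonneg ha0)] at hDn
  refine ⟨fun ξ => ⟨(tsum_operator_Lp hAs ξ (hAF ξ)).1, (tsum_operator_Lp hBs ξ (hBF ξ)).1,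
    (tsum_operator_Lp hDs ξ (hDF ξ)).1⟩, ?_⟩
  obtain ⟨T, hTn, hT⟩ := exists_pointwise_matVec_operator hGmeas hGbdd
  refine ⟨T + ∑' k, A k + ∑' k, B k + ∑' p, D p, ?_, fun ξ => ?_⟩
  · have hamgm : 2 * (Real.sqrt (∑' k, a k) * Real.sqrt (∑' k, b k)) ≤
        ∑' k, a k + ∑' k, b k := by
      have h := two_mul_le_add_sq (Real.sqrt (∑' k, a k)) (Real.sqrt (∑' k, b k))
      rw [Real.sq_sqrt (tsum_nonneg ha0), Real.sq_sqrt (tsum_nonneg hb0)] at h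
      linarith
    have htri := norm_add₄_le (a := T) (b := ∑' k, A k) (c := ∑' k, B k) (d := ∑' p, D p)
    linarith
  · simp only [add_apply]
    filter_upwards [Lp.coeFn_add (T ξ + (∑' k, A k) ξ + (∑' k, B k) ξ) ((∑' p, D p) ξ),
      Lp.coeFn_add (T ξ + (∑' k, A k) ξ) ((∑' k, B k) ξ), Lp.coeFn_add (T ξ) ((∑' k, A k) ξ),
      hT ξ, (tsum_operator_Lp hAs ξ (hAF ξ)).2, (tsum_operator_Lp hBs ξ (hBF ξ)).2,
      (tsum_operator_Lp hDs ξ (hDF ξ)).2] with ω h₁ h₂ h₃ h₄ h₅ h₆ h₇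
    rw [h₁, Pi.add_apply, h₂, Pi.add_apply, h₃, Pi.add_apply, h₄, h₅, h₆, h₇]
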